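/- The composition *^{A^T} ∘ *^A commutes with e_i and with e_i^∨ for every 1 ≤ i ≤ n; hence it commutes with the entire action of the Clifford algebra Cl_n(F) on ⋀(F^n). -/

import Mathlib

open scoped BigOperators
open Matrix

/-- The model for the exterior algebra `⋀(Fⁿ)`: the free `F`-module on the set of
standard basis monomials `e_S = e_{s_1} ∧ … ∧ e_{s_k}`, `s_1 < … < s_k`,
indexed by finite subsets `S`. -/
abbrev ExtV (F : Type) (ι : Type) := Finset ι → F

/-- Exterior multiplication by `e_i` on `⋀(Fⁿ)`. -/
noncomputable def mulE (F : Type) [Field F] {ι : Type} [LinearOrder ι] (i : ι) :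
    ExtV F ι →ₗ[F] ExtV F ι where
  toFun f S := if i ∈ S then (-1 : F) ^ (S.filter (· < i)).card * f (S.erase i) else 0
  map_add' f g := by
    funext S
    by_cases h : i ∈ S <;> simp [h, mul_add]
  map_smul' a f := by
    funext S
    by_cases h : i ∈ S <;> simp [h, mul_left_comm]

/-- Contraction `e_i^∨` on `⋀(Fⁿ)`. -/
noncomputable def contrE (F : Type) [Field F] {ι : Type} [LinearOrder ι] (i : ι) :
    ExtV F ι →ₗ[F] ExtV F ι where
  toFun f S := if i ∈ S then 0 else (-1 : F) ^ (S.filter (· < i)).card * f (insert i S)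
  map_add' f g := by
    funext S
    by_cases h : i ∈ S <;> simp [h, mul_add]
  map_smul' a f := by
    funext S
    by_cases h : i ∈ S <;> simp [h, mul_left_comm]

/-- `E_{A,i} = π ∑_j A_{ij} e_j`. -/
noncomputable def EA (F : Type) [Field F] {ι : Type} [Fintype ι] [LinearOrder ι]
    (π : F) (A : Matrix ι ι ℕ) (i : ι) : ExtV F ι →ₗ[F] ExtV F ι :=
  π • ∑ j, (A i j : F) • mulE F j

/-- `E^∨_{A,i} = π⁻¹ ∑_j (A⁻¹)_{ji} e_j^∨`, the inverse matrix being computed over `F`. -/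
noncomputable def EAdual (F : Type) [Field F] {ι : Type} [Fintype ι] [LinearOrder ι]
    (π : F) (A : Matrix ι ι ℕ) (i : ι) : ExtV F ι →ₗ[F] ExtV F ι :=
  π⁻¹ • ∑ j, ((A.map ((↑) : ℕ → F))⁻¹ j i) • contrE F j

/-- The element `E_{Aᵀ,1} E_{Aᵀ,2} ⋯ E_{Aᵀ,n} (1) ∈ ⋀(Fⁿ)`. -/
noncomputable def starTop (F : Type) [Field F] {ι : Type} [Fintype ι] [LinearOrder ι]
    (π : F) (A : Matrix ι ι ℕ) : ExtV F ι :=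
  (Finset.univ.sort (· ≤ ·)).foldr (fun i v => EA F π Aᵀ i v)
    (Pi.single (∅ : Finset ι) (1 : F))

/-- Borisov's duality operator `*^A`, defined on the standard basis by
`*^A(e_{i_1} ∧ … ∧ e_{i_k}) = E^∨_{Aᵀ,i_1} ⋯ E^∨_{Aᵀ,i_k}(E_{Aᵀ,1} ⋯ E_{Aᵀ,n}(1))`
for `i_1 < … < i_k`. -/
noncomputable def starA (F : Type) [Field F] {ι : Type} [Fintype ι] [LinearOrder ι]
    (π : F) (A : Matrix ι ι ℕ) : ExtV F ι →ₗ[F] ExtV F ι :=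
  (Pi.basisFun F (Finset ι)).constr F fun S =>
    (S.sort (· ≤ ·)).foldr (fun i v => EAdual F π Aᵀ i v) (starTop F π A)

section ExteriorOperators

variable {F : Type} [Field F] {ι : Type} [LinearOrder ι]

/-- The sign picked up by moving `e_i` past the factors of `e_S` with smaller index. -/
def koszulSign (F : Type) [Field F] (i : ι) (S : Finset ι) : F :=
  (-1 : F) ^ (S.filter (· < i)).card

theorem koszulSign_mul_self (i : ι) (S : Finset ι) :
    koszulSign F i S * koszulSign F i S = 1 := by
  simp [koszulSign, ← mul_pow]

theorem koszulSign_insert {i j : ι} {S : Finset ι} (hj : j ∉ S) :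
    koszulSign F i (insert j S) = if j < i then -koszulSign F i S else koszulSign F i S := by
  unfold koszulSign
  rw [Finset.filter_insert]
  split_ifs with h
  · rw [Finset.card_insert_of_notMem (by simp [hj]), pow_succ]
    ring
  · rfl

theorem koszulSign_erase {i j : ι} {S : Finset ι} (hj : j ∈ S) :
    koszulSign F i (S.erase j) = if j < i then -koszulSign F i S else koszulSign F i S := by
  have h := koszulSign_insert (F := F) (i := i) (Finset.notMem_erase j S)
  rw [Finset.insert_erase hj] at h
  split_ifs with hlt
  · rw [if_pos hlt] at h
    rw [h, neg_neg]
  · rw [if_neg hlt] at h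
    exact h.symm

theorem koszulSign_eq_one {i : ι} {S : Finset ι} (h : ∀ j ∈ S, i < j) :
    koszulSign F i S = 1 := by
  have : S.filter (· < i) = ∅ := Finset.filter_eq_empty_iff.2 fun j hj => (h j hj).not_gt
  simp [koszulSign, this]

theorem mulE_apply (i : ι) (f : ExtV F ι) (S : Finset ι) :
    mulE F i f S = if i ∈ S then koszulSign F i S * f (S.erase i) else 0 := rfl

theorem contrE_apply (i : ι) (f : ExtV F ι) (S : Finset ι) :
    contrE F i f S = if i ∈ S then 0 else koszulSign F i S * f (insert i S) := rfl

theorem mulE_mulE_self (i : ι) : mulE F i * mulE F i = 0 := by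
  refine LinearMap.ext fun f => funext fun S => ?_
  simp [mulE_apply]

theorem contrE_contrE_self (i : ι) : contrE F i * contrE F i = 0 := by
  refine LinearMap.ext fun f => funext fun S => ?_
  simp [contrE_apply]

theorem mulE_mulE_anticomm (i j : ι) : mulE F i * mulE F j + mulE F j * mulE F i = 0 := by
  rcases eq_or_ne i j with rfl | hij
  · simp [mulE_mulE_self]
  refine LinearMap.ext fun f => funext fun S => ?_
  by_cases hi : i ∈ S <;> by_cases hj : j ∈ S <;>
    simp [mulE_apply, hi, hj, hij, hij.symm, koszulSign_erase, Finset.erase_right_comm (a := j)]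
  rcases hij.lt_or_gt with h | h <;> simp [h, h.not_gt] <;> ring

theorem contrE_contrE_anticomm (i j : ι) :
    contrE F i * contrE F j + contrE F j * contrE F i = 0 := by
  rcases eq_or_ne i j with rfl | hij
  · simp [contrE_contrE_self]
  refine LinearMap.ext fun f => funext fun S => ?_
  by_cases hi : i ∈ S <;> by_cases hj : j ∈ S <;>
    simp [contrE_apply, hi, hj, hij, hij.symm, koszulSign_insert, Finset.insert_comm j i]
  rcases hij.lt_or_gt with h | h <;> simp [h, h.not_gt] <;> ring

theorem mulE_contrE_anticomm (i j : ι) :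
    mulE F i * contrE F j + contrE F j * mulE F i = if i = j then 1 else 0 := by
  rcases eq_or_ne i j with rfl | hij
  · refine LinearMap.ext fun f => funext fun S => ?_
    by_cases hi : i ∈ S <;>
      simp [mulE_apply, contrE_apply, hi, koszulSign_erase, koszulSign_insert, ← mul_assoc,
        koszulSign_mul_self]
  · refine LinearMap.ext fun f => funext fun S => ?_
    by_cases hi : i ∈ S <;> by_cases hj : j ∈ S <;>
      simp [mulE_apply, contrE_apply, hi, hj, hij, hij.symm, koszulSign_insert, koszulSign_erase,
        Finset.erase_insert_of_ne]
    rcases hij.lt_or_gt with h | h <;> simp [h, h.not_gt] <;> ring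

theorem mulE_single (i : ι) (S : Finset ι) :
    mulE F i (Pi.single S 1) =
      if i ∈ S then 0 else koszulSign F i S • (Pi.single (insert i S) 1 : ExtV F ι) := by
  funext T
  by_cases hi : i ∈ S
  · have : T.erase i ≠ S := fun h => Finset.notMem_erase i T (h ▸ hi)
    simp [mulE_apply, hi, this]
  · by_cases hT : T = insert i S
    · subst hT
      simp [mulE_apply, hi, koszulSign_insert]
    · have : i ∈ T → T.erase i ≠ S := fun h h' => hT (by rw [← h', Finset.insert_erase h])
      simp +contextual [mulE_apply, hi, hT, this]

theorem contrE_single (i : ι) (S : Finset ι) :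
    contrE F i (Pi.single S 1) =
      if i ∈ S then koszulSign F i S • (Pi.single (S.erase i) 1 : ExtV F ι) else 0 := by
  funext T
  by_cases hi : i ∈ S
  · by_cases hT : T = S.erase i
    · subst hT
      simp [contrE_apply, hi, koszulSign_erase]
    · have : i ∉ T → insert i T ≠ S := fun h h' => hT (by rw [← h', Finset.erase_insert h])
      simp +contextual [contrE_apply, hi, hT, this]
  · have : insert i T ≠ S := fun h => hi (h ▸ Finset.mem_insert_self i T)
    simp [contrE_apply, hi, this]

end ExteriorOperators

section OrderedProducts

variable {F : Type} [Field F] {ι : Type} [LinearOrder ι] {V : Type} [AddCommGroup V] [Module F V]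

/-- `a_{i_1} ⋯ a_{i_k} v` for `S = {i_1 < ⋯ < i_k}`. -/
def orderedApply (a : ι → Module.End F V) (v : V) (S : Finset ι) : V :=
  (S.sort (· ≤ ·)).foldr (fun i w => a i w) v

theorem orderedApply_insert_of_lt (a : ι → Module.End F V) (v : V) {i : ι} {S : Finset ι}
    (h : ∀ j ∈ S, i < j) : orderedApply a v (insert i S) = a i (orderedApply a v S) := by
  unfold orderedApply
  rw [Finset.sort_insert _ (fun j hj => (h j hj).le) (fun hi => (h i hi).false)]
  rfl

theorem apply_orderedApply {a : ι → Module.End F V} (hsq : ∀ i, a i * a i = 0)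
    (hanti : ∀ i j, a i * a j + a j * a i = 0) (v : V) (i : ι) (S : Finset ι) :
    a i (orderedApply a v S) =
      if i ∈ S then 0 else koszulSign F i S • orderedApply a v (insert i S) := by
  have hsq' (i) (w : V) : a i (a i w) = 0 := LinearMap.congr_fun (hsq i) w
  have hanti' (i j) (w : V) : a i (a j w) = -a j (a i w) :=
    eq_neg_of_add_eq_zero_left (LinearMap.congr_fun (hanti i j) w)
  induction S using Finset.induction_on_min with
  | empty =>
    have := orderedApply_insert_of_lt a v (i := i) (S := ∅) (by simp)
    simpa [koszulSign] using this.symm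
  | insert m S hm ih =>
    have hmS : m ∉ S := fun h => (hm m h).false
    rcases lt_trichotomy i m with h | rfl | h
    · have hlt : ∀ j ∈ insert m S, i < j := by
        simpa [h] using fun j hj => h.trans (hm j hj)
      rw [if_neg fun hi => (hlt i hi).false, koszulSign_eq_one hlt, one_smul,
        orderedApply_insert_of_lt a v hlt]
    · rw [orderedApply_insert_of_lt a v hm, hsq', if_pos (Finset.mem_insert_self i S)]
    · rw [orderedApply_insert_of_lt a v hm, hanti', ih]
      by_cases hi : i ∈ S
      · simp [hi]
      · have hlt : ∀ j ∈ insert i S, m < j := by simpa [h] using hm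
        rw [Finset.insert_comm, orderedApply_insert_of_lt a v hlt, koszulSign_insert hmS]
        simp [hi, h, h.ne']

theorem annihilator_orderedApply {a b : ι → Module.End F V}
    (hanti : ∀ i j, b i * a j + a j * b i = if i = j then 1 else 0) {v : V}
    (hv : ∀ i, b i v = 0) (i : ι) (S : Finset ι) :
    b i (orderedApply a v S) =
      if i ∈ S then koszulSign F i S • orderedApply a v (S.erase i) else 0 := by
  have hanti' (i j) (w : V) : b i (a j w) = (if i = j then w else 0) - a j (b i w) := by
    refine eq_sub_of_add_eq ((LinearMap.congr_fun (hanti i j) w).trans ?_)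
    split_ifs <;> rfl
  induction S using Finset.induction_on_min with
  | empty => simp [orderedApply, hv]
  | insert m S hm ih =>
    have hmS : m ∉ S := fun h => (hm m h).false
    rw [orderedApply_insert_of_lt a v hm, hanti', ih]
    rcases eq_or_ne i m with rfl | hne
    · simp [hmS, koszulSign_insert hmS, koszulSign_eq_one hm]
    · by_cases hi : i ∈ S
      · have hlt : ∀ j ∈ S.erase i, m < j := fun j hj => hm j (Finset.mem_of_mem_erase hj)
        rw [Finset.erase_insert_of_ne hne.symm, orderedApply_insert_of_lt a v hlt,
          koszulSign_insert hmS]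
        simp [hi, hne, hm i hi]
      · simp [hi, hne]

end OrderedProducts

section StarOperator

theorem sum_smul_mul_self {F R ι : Type*} [CommRing F] [Ring R] [Algebra F R] {x : ι → R}
    (hsq : ∀ i, x i * x i = 0) (hanti : ∀ i j, x i * x j + x j * x i = 0) (c : ι → F)
    (s : Finset ι) : (∑ i ∈ s, c i • x i) * ∑ i ∈ s, c i • x i = 0 := by
  classical
  induction s using Finset.induction_on with
  | empty => simp
  | insert k s hk ih =>
    have hcross : (c k • x k) * (∑ i ∈ s, c i • x i) + (∑ i ∈ s, c i • x i) * (c k • x k) = 0 := by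
      rw [Finset.mul_sum, Finset.sum_mul, ← Finset.sum_add_distrib]
      refine Finset.sum_eq_zero fun i _ => ?_
      rw [smul_mul_smul_comm, smul_mul_smul_comm, mul_comm (c i), ← smul_add, hanti, smul_zero]
    rw [Finset.sum_insert hk, add_mul, mul_add, mul_add, ih, smul_mul_smul_comm, hsq, smul_zero,
      zero_add, add_zero, hcross]

theorem sum_smul_mul_sum_smul_add {F R ι : Type*} [CommRing F] [Ring R] [Algebra F R]
    [Fintype ι] {x y : ι → R} {g : ι → ι → R} (h : ∀ i j, x i * y j + y j * x i = g i j)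
    (c d : ι → F) :
    (∑ i, c i • x i) * (∑ j, d j • y j) + (∑ j, d j • y j) * (∑ i, c i • x i) =
      ∑ i, ∑ j, (c i * d j) • g i j := by
  rw [Finset.sum_mul_sum, Finset.sum_mul_sum, Finset.sum_comm (s := Finset.univ) (t := Finset.univ)
    (f := fun j i => d j • y j * c i • x i), ← Finset.sum_add_distrib]
  refine Finset.sum_congr rfl fun i _ => ?_
  rw [← Finset.sum_add_distrib]
  refine Finset.sum_congr rfl fun j _ => ?_
  rw [smul_mul_smul_comm, smul_mul_smul_comm, mul_comm (d j), ← smul_add, h]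

variable {F : Type} [Field F] {ι : Type} [Fintype ι] [LinearOrder ι]

/-- `mulE` with values in the ring of endomorphisms. -/
noncomputable abbrev mulEnd (F : Type) [Field F] (i : ι) : Module.End F (ExtV F ι) := mulE F i

/-- `contrE` with values in the ring of endomorphisms. -/
noncomputable abbrev contrEnd (F : Type) [Field F] (i : ι) : Module.End F (ExtV F ι) := contrE F i

theorem EA_eq_sum (π : F) (A : Matrix ι ι ℕ) (i : ι) :
    EA F π A i = ∑ j, (π * (A i j : F)) • mulEnd F j := by
  simp only [mul_smul]
  exact Finset.smul_sum

theorem EAdual_eq_sum (π : F) (A : Matrix ι ι ℕ) (i : ι) :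
    EAdual F π A i = ∑ j, (π⁻¹ * (A.map ((↑) : ℕ → F))⁻¹ j i) • contrEnd F j := by
  simp only [mul_smul]
  exact Finset.smul_sum

theorem EA_mul_self (π : F) (A : Matrix ι ι ℕ) (i : ι) : EA F π A i * EA F π A i = 0 := by
  rw [EA_eq_sum]
  exact sum_smul_mul_self mulE_mulE_self mulE_mulE_anticomm _ _

theorem EAdual_mul_self (π : F) (A : Matrix ι ι ℕ) (i : ι) :
    EAdual F π A i * EAdual F π A i = 0 := by
  rw [EAdual_eq_sum]
  exact sum_smul_mul_self contrE_contrE_self contrE_contrE_anticomm _ _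

theorem EA_anticomm (π : F) (A : Matrix ι ι ℕ) (i j : ι) :
    EA F π A i * EA F π A j + EA F π A j * EA F π A i = 0 := by
  rw [EA_eq_sum, EA_eq_sum]
  exact (sum_smul_mul_sum_smul_add mulE_mulE_anticomm _ _).trans (by simp)

theorem EAdual_anticomm (π : F) (A : Matrix ι ι ℕ) (i j : ι) :
    EAdual F π A i * EAdual F π A j + EAdual F π A j * EAdual F π A i = 0 := by
  rw [EAdual_eq_sum, EAdual_eq_sum]
  exact (sum_smul_mul_sum_smul_add contrE_contrE_anticomm _ _).trans (by simp)

theorem EA_EAdual_anticomm {π : F} (hπ : π ≠ 0) {A : Matrix ι ι ℕ}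
    (hdet : IsUnit (A.map ((↑) : ℕ → F)).det) (i j : ι) :
    EA F π A i * EAdual F π A j + EAdual F π A j * EA F π A i = if i = j then 1 else 0 := by
  have h : ∑ k, (A i k : F) * (A.map ((↑) : ℕ → F))⁻¹ k j = (1 : Matrix ι ι F) i j := by
    rw [← Matrix.mul_nonsing_inv _ hdet, Matrix.mul_apply]
    rfl
  have hcancel (x y : F) : π * x * (π⁻¹ * y) = x * y := by field_simp
  rw [EA_eq_sum, EAdual_eq_sum]
  refine (sum_smul_mul_sum_smul_add mulE_contrE_anticomm _ _).trans ?_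
  simp only [hcancel, smul_ite, smul_zero, Finset.sum_ite_eq, Finset.mem_univ, if_true,
    ← Finset.sum_smul, h, Matrix.one_apply, ite_smul, one_smul, zero_smul]

theorem starTop_eq (π : F) (A : Matrix ι ι ℕ) :
    starTop F π A = orderedApply (EA F π Aᵀ) (Pi.single ∅ 1) Finset.univ := rfl

theorem EA_starTop (π : F) (A : Matrix ι ι ℕ) (i : ι) : EA F π Aᵀ i (starTop F π A) = 0 := by
  rw [starTop_eq, apply_orderedApply (EA_mul_self π Aᵀ) (EA_anticomm π Aᵀ),
    if_pos (Finset.mem_univ i)]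

theorem starA_single (π : F) (A : Matrix ι ι ℕ) (S : Finset ι) :
    starA F π A (Pi.single S 1) = orderedApply (EAdual F π Aᵀ) (starTop F π A) S := by
  rw [← Pi.basisFun_apply, starA, Module.Basis.constr_basis]
  rfl

theorem starA_mul_mulE (π : F) (A : Matrix ι ι ℕ) (i : ι) :
    starA F π A * mulE F i = EAdual F π Aᵀ i * starA F π A := by
  refine (Pi.basisFun F (Finset ι)).ext fun S => ?_
  rw [Pi.basisFun_apply, Module.End.mul_apply, Module.End.mul_apply, mulE_single, starA_single,
    apply_orderedApply (EAdual_mul_self π Aᵀ) (EAdual_anticomm π Aᵀ)]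
  split_ifs
  · exact map_zero _
  · rw [map_smul, starA_single]

theorem starA_mul_contrE {π : F} (hπ : π ≠ 0) {A : Matrix ι ι ℕ}
    (hdet : IsUnit (A.map ((↑) : ℕ → F)).det) (i : ι) :
    starA F π A * contrE F i = EA F π Aᵀ i * starA F π A := by
  have hdetT : IsUnit (Aᵀ.map ((↑) : ℕ → F)).det := by
    rwa [Matrix.transpose_map, Matrix.det_transpose]
  refine (Pi.basisFun F (Finset ι)).ext fun S => ?_
  rw [Pi.basisFun_apply, Module.End.mul_apply, Module.End.mul_apply, contrE_single, starA_single,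
    annihilator_orderedApply (EA_EAdual_anticomm hπ hdetT) (EA_starTop π A)]
  split_ifs
  · rw [map_smul, starA_single]
  · exact map_zero _

theorem starA_transpose_mul_EAdual {π : F} (hπ : π ≠ 0) {A : Matrix ι ι ℕ}
    (hdet : IsUnit (A.map ((↑) : ℕ → F)).det) (i : ι) :
    starA F π Aᵀ * EAdual F π Aᵀ i = mulE F i * starA F π Aᵀ := by
  have hdetT : IsUnit (Aᵀ.map ((↑) : ℕ → F)).det := by
    rwa [Matrix.transpose_map, Matrix.det_transpose]
  have h (k : ι) : ∑ j, (Aᵀ.map ((↑) : ℕ → F))⁻¹ j i * (A j k : F) = (1 : Matrix ι ι F) i k := by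
    rw [Matrix.transpose_map, ← Matrix.transpose_nonsing_inv, ← Matrix.nonsing_inv_mul _ hdet,
      Matrix.mul_apply]
    rfl
  have hcancel (x y : F) : π⁻¹ * x * (π * y) = x * y := by field_simp
  have hsum : ∑ j, (π⁻¹ * (Aᵀ.map ((↑) : ℕ → F))⁻¹ j i) • EA F π A j = mulE F i := by
    simp only [EA_eq_sum, Finset.smul_sum, smul_smul, hcancel]
    rw [Finset.sum_comm]
    simp only [← Finset.sum_smul, h, Matrix.one_apply, ite_smul, one_smul, zero_smul,
      Finset.sum_ite_eq, Finset.mem_univ, if_true]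
  have hmul (j : ι) : starA F π Aᵀ * contrEnd F j = EA F π A j * starA F π Aᵀ :=
    starA_mul_contrE hπ hdetT j
  rw [← hsum, EAdual_eq_sum, Finset.mul_sum, Finset.sum_mul]
  simp only [mul_smul_comm, smul_mul_assoc, hmul]

theorem starA_transpose_mul_EA {π : F} (hπ : π ≠ 0) {A : Matrix ι ι ℕ}
    (hdet : IsUnit (A.map ((↑) : ℕ → F)).det) (i : ι) :
    starA F π Aᵀ * EA F π Aᵀ i = contrE F i * starA F π Aᵀ := by
  have h (k : ι) : ∑ j, (Aᵀ i j : F) * (A.map ((↑) : ℕ → F))⁻¹ k j = (1 : Matrix ι ι F) k i := by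
    rw [← Matrix.nonsing_inv_mul _ hdet, Matrix.mul_apply]
    exact Finset.sum_congr rfl fun j _ => mul_comm _ _
  have hcancel (x y : F) : π * x * (π⁻¹ * y) = x * y := by field_simp
  have hsum : ∑ j, (π * (Aᵀ i j : F)) • EAdual F π A j = contrE F i := by
    simp only [EAdual_eq_sum, Finset.smul_sum, smul_smul, hcancel]
    rw [Finset.sum_comm]
    simp only [← Finset.sum_smul, h, Matrix.one_apply, ite_smul, one_smul, zero_smul,
      Finset.sum_ite_eq', Finset.mem_univ, if_true]
  have hmul (j : ι) : starA F π Aᵀ * mulEnd F j = EAdual F π A j * starA F π Aᵀ :=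
    starA_mul_mulE π Aᵀ j
  rw [← hsum, EA_eq_sum, Finset.mul_sum, Finset.sum_mul]
  simp only [mul_smul_comm, smul_mul_assoc, hmul]

theorem starAT_starA_commute_mulE {π : F} (hπ : π ≠ 0) {A : Matrix ι ι ℕ}
    (hdet : IsUnit (A.map ((↑) : ℕ → F)).det) (i : ι) :
    Commute (starA F π Aᵀ * starA F π A) (mulE F i) := by
  rw [Commute, SemiconjBy, mul_assoc, starA_mul_mulE, ← mul_assoc,
    starA_transpose_mul_EAdual hπ hdet, mul_assoc]

theorem starAT_starA_commute_contrE {π : F} (hπ : π ≠ 0) {A : Matrix ι ι ℕ}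
    (hdet : IsUnit (A.map ((↑) : ℕ → F)).det) (i : ι) :
    Commute (starA F π Aᵀ * starA F π A) (contrE F i) := by
  rw [Commute, SemiconjBy, mul_assoc, starA_mul_contrE hπ hdet, ← mul_assoc,
    starA_transpose_mul_EA hπ hdet, mul_assoc]

end StarOperator

/-- The composite `*^{Aᵀ} ∘ *^A` commutes with each `e_i` and each `e_i^∨`, and hence
with the whole action of the Clifford algebra `Cl_n(F)` on `⋀(Fⁿ)` (i.e. with every
element of the subalgebra of endomorphisms generated by the `e_i` and `e_i^∨`). -/
theorem starAT_starA_central (F : Type) [Field F] (n : ℕ) (π : F) (hπ : π ≠ 0)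
    (A : Matrix (Fin n) (Fin n) ℕ) (hdet : IsUnit ((A.map ((↑) : ℕ → F)).det)) :
    (∀ i : Fin n,
      ((starA F π Aᵀ).comp (starA F π A)).comp (mulE F i) =
        (mulE F i).comp ((starA F π Aᵀ).comp (starA F π A)) ∧
      ((starA F π Aᵀ).comp (starA F π A)).comp (contrE F i) =
        (contrE F i).comp ((starA F π Aᵀ).comp (starA F π A))) ∧
    (∀ L : Module.End F (ExtV F (Fin n)),
      L ∈ Algebra.adjoin F
        (Set.range (fun i : Fin n => (mulE F i : Module.End F (ExtV F (Fin n)))) ∪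
         Set.range (fun i : Fin n => (contrE F i : Module.End F (ExtV F (Fin n))))) →
      Commute ((starA F π Aᵀ).comp (starA F π A) : Module.End F (ExtV F (Fin n))) L) := by
  refine ⟨fun i => ⟨starAT_starA_commute_mulE hπ hdet i, starAT_starA_commute_contrE hπ hdet i⟩,
    fun L hL => ?_⟩
  induction hL using Algebra.adjoin_induction with
  | mem x hx =>
    rcases hx with ⟨i, rfl⟩ | ⟨i, rfl⟩
    · exact starAT_starA_commute_mulE hπ hdet i
    · exact starAT_starA_commute_contrE hπ hdet i
  | algebraMap r => exact Algebra.commute_algebraMap_right r _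
  | add x y _ _ hx hy => exact hx.add_right hy
  | mul x y _ _ hx hy => exact hx.mul_right hy
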